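/- Let G be a group such that every element of B_p(G) is trivial, where B_p(G) is the set of values of the full balanced commutator tree of height p. Then the p-th derived subgroup G^{(p)} is trivial, i.e., G is solvable of derived length at most p. -/

import Mathlib

def gcomm {G : Type*} [Group G] (a b : G) : G := a⁻¹ * b⁻¹ * a * b

def Bset (G : Type*) [Group G] : ℕ → Set G
  | 0 => Set.univ
  | p + 1 => {z | ∃ x ∈ Bset G p, ∃ y ∈ Bset G p, z = gcomm x y}

open scoped commutatorElement

theorem gcomm_eq_commutatorElement {G : Type*} [Group G] (a b : G) :
    gcomm a b = ⁅a⁻¹, b⁻¹⁆ := by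
  simp [gcomm, commutatorElement_def]

theorem gcomm_eq_one_iff_commute {G : Type*} [Group G] (a b : G) :
    gcomm a b = 1 ↔ Commute a b := by
  rw [gcomm_eq_commutatorElement, commutatorElement_eq_one_iff_commute,
    Commute.inv_inv_iff]

theorem map_gcomm {G H : Type*} [Group G] [Group H] (f : G →* H) (a b : G) :
    f (gcomm a b) = gcomm (f a) (f b) := by
  simp [gcomm]

theorem conj_mem_Bset {G : Type*} [Group G] (g : G) {p : ℕ} {x : G} (hx : x ∈ Bset G p) :
    g * x * g⁻¹ ∈ Bset G p := by
  induction p generalizing x with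
  | zero => trivial
  | succ p ih =>
    obtain ⟨a, ha, b, hb, rfl⟩ := hx
    exact ⟨_, ih ha, _, ih hb, map_gcomm (MulAut.conj g).toMonoidHom a b⟩

theorem closure_Bset_normal (G : Type*) [Group G] (p : ℕ) :
    (Subgroup.closure (Bset G p)).Normal := by
  rw [← Subgroup.normalizer_eq_top_iff, eq_top_iff, Subgroup.le_normalizer_closure_iff]
  exact fun g _ x hx => Subgroup.subset_closure (conj_mem_Bset g hx)

theorem commutator_closure_le {G : Type*} [Group G] {S : Set G} {K : Subgroup G} [K.Normal]
    (h : ∀ x ∈ S, ∀ y ∈ S, gcomm x y ∈ K) :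
    ⁅Subgroup.closure S, Subgroup.closure S⁆ ≤ K := by
  have mem_iff (x y : G) : gcomm x y ∈ K ↔ Commute (x : G ⧸ K) (y : G ⧸ K) := by
    rw [← gcomm_eq_one_iff_commute, ← QuotientGroup.eq_one_iff]
    rfl
  rw [Subgroup.commutator_le]
  intro x hx y hy
  rw [← QuotientGroup.eq_one_iff]
  refine commutatorElement_eq_one_iff_commute.mpr
    (?_ : Commute (x : G ⧸ K) (y : G ⧸ K))
  induction hx, hy using Subgroup.closure_induction₂ with
  | mem x y hx hy => exact (mem_iff x y).mp (h x hx y hy)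
  | one_left => exact Commute.one_left _
  | one_right => exact Commute.one_right _
  | mul_left _ _ _ _ _ _ h₁ h₂ => exact h₁.mul_left h₂
  | mul_right _ _ _ _ _ _ h₁ h₂ => exact h₁.mul_right h₂
  | inv_left _ _ _ _ h => exact h.inv_left
  | inv_right _ _ _ _ h => exact h.inv_right

theorem derivedSeries_le_closure_Bset (G : Type*) [Group G] (p : ℕ) :
    derivedSeries G p ≤ Subgroup.closure (Bset G p) := by
  induction p with
  | zero => simp [Bset]
  | succ p ih =>
    have := closure_Bset_normal G (p + 1)
    exact (Subgroup.commutator_mono ih ih).trans <| commutator_closure_le fun x hx y hy =>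
      Subgroup.subset_closure ⟨x, hx, y, hy, rfl⟩

theorem Bset_trivial_implies_derived_trivial (G : Type*) [Group G] (p : ℕ)
    (h : ∀ x ∈ Bset G p, x = 1) : derivedSeries G p = ⊥ := by
  rw [eq_bot_iff]
  exact (derivedSeries_le_closure_Bset G p).trans
    ((Subgroup.closure_le ⊥).mpr fun x hx => Subgroup.mem_bot.mpr (h x hx))
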